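/- Let N = (N_i)_{i≥0} be a reduced sequence of nonnegative real matrices with alphabets (A_i), and assume that N itself is not primitive. Then for every reduced primitive proper stream α (with α_i ⊆ A_i) there exist k ≥ 0 and an infinite vertex path x = (x_i)_{i≥k} with x_i ∉ α_i for all i ≥ k; that is, the singlet stream of x is disjoint from α. -/

import Mathlib

open Filter Topology Matrix

noncomputable section

/-- The product `N_k N_{k+1} ⋯ N_{k+m}` of a nonstationary sequence of matrices,
i.e. the matrix written `N_k^n` (with `n = k + m`) in the paper. -/
def matProd {A : ℕ → Type} [∀ i, Fintype (A i)]
    (N : ∀ i, Matrix (A i) (A (i + 1)) ℝ) (k : ℕ) :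
    ∀ m : ℕ, Matrix (A k) (A (k + m + 1)) ℝ
  | 0 => N k
  | m + 1 => matProd N k m * N (k + m + 1)

/-- `V_N^0`: nonnegative fixed-point sequences (`w_i ∈ C_i`, `w_i = N_i w_{i+1}`). -/
def V0 {A : ℕ → Type} [∀ i, Fintype (A i)] (N : ∀ i, Matrix (A i) (A (i + 1)) ℝ) :
    Set (∀ i, A i → ℝ) :=
  {w | (∀ i a, 0 ≤ w i a) ∧ ∀ i, w i = (N i).mulVec (w (i + 1))}

/-- `V_N`: nonnegative eigenvector sequences of eigenvalue one (never zero). -/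
def Vpos {A : ℕ → Type} [∀ i, Fintype (A i)] (N : ∀ i, Matrix (A i) (A (i + 1)) ℝ) :
    Set (∀ i, A i → ℝ) := {w | w ∈ V0 N ∧ ∀ i, w i ≠ 0}

/-- `V_N^Δ`: members of `V_N` whose initial vector lies in the unit simplex `Δ₀`
(for the `L¹` norm `‖u‖ = ∑ₐ |u a|`). -/
def VDelta {A : ℕ → Type} [∀ i, Fintype (A i)] (N : ∀ i, Matrix (A i) (A (i + 1)) ℝ) :
    Set (∀ i, A i → ℝ) := {w | w ∈ Vpos N ∧ ∑ a, |w 0 a| = 1}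

/-- The sequence `N` is primitive: for every `k` there is `n > k` (here `n = k + m`, `m ≥ 1`)
such that every entry of `N_k^n` is strictly positive. -/
def Primitive {A : ℕ → Type} [∀ i, Fintype (A i)] (N : ∀ i, Matrix (A i) (A (i + 1)) ℝ) : Prop :=
  ∀ k, ∃ m, 0 < m ∧ ∀ (a : A k) (b : A (k + m + 1)), 0 < matProd N k m a b

/-- The submatrix sequence of `N` determined by a stream `α` (a sequence of sub-alphabets). -/
def subMat {A : ℕ → Type} (N : ∀ i, Matrix (A i) (A (i + 1)) ℝ) (α : ∀ i, Finset (A i)) :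
    ∀ i, Matrix (↥(α i)) (↥(α (i + 1))) ℝ :=
  fun i => Matrix.of fun a b => N i a.1 b.1

/-- A stream is proper with starting time `k`: empty before `k`, nonempty from `k` on. -/
def StreamProper {A : ℕ → Type} (α : ∀ i, Finset (A i)) (k : ℕ) : Prop :=
  (∀ i, i < k → α i = ∅) ∧ ∀ i, k ≤ i → (α i).Nonempty

/-- A stream is reduced (from time `k` on): its submatrix sequence has no all-zero row
or column. -/
def StreamReduced {A : ℕ → Type} (N : ∀ i, Matrix (A i) (A (i + 1)) ℝ)
    (α : ∀ i, Finset (A i)) (k : ℕ) : Prop :=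
  ∀ i, k ≤ i →
    (∀ a : ↥(α i), ∃ b : ↥(α (i + 1)), subMat N α i a b ≠ 0) ∧
    (∀ b : ↥(α (i + 1)), ∃ a : ↥(α i), subMat N α i a b ≠ 0)

/-- A stream is primitive (from time `k` on): its submatrix sequence is primitive. -/
def StreamPrimitive {A : ℕ → Type} [∀ i, Fintype (A i)]
    (N : ∀ i, Matrix (A i) (A (i + 1)) ℝ) (α : ∀ i, Finset (A i)) (k : ℕ) : Prop :=
  ∀ j, k ≤ j → ∃ m, 0 < m ∧ ∀ (a : ↥(α j)) (b : ↥(α (j + m + 1))),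
    0 < matProd (A := fun i => ↥(α i)) (subMat N α) j m a b

/-- `Reach N a j b`: some vertex path (possibly of length zero) leads from `a` to `b : A j`. -/
inductive Reach {A : ℕ → Type} (N : ∀ i, Matrix (A i) (A (i + 1)) ℝ) {i : ℕ} (a : A i) :
    ∀ j, A j → Prop
  | refl : Reach N a i a
  | snoc {j : ℕ} {b : A j} {c : A (j + 1)} : Reach N a j b → 0 < N j b c → Reach N a (j + 1) c

/-- `Avoids N α m i a`: some vertex path with `m` edges starting at `a : A i` avoids `α`. -/
def Avoids {A : ℕ → Type} (N : ∀ i, Matrix (A i) (A (i + 1)) ℝ) (α : ∀ i, Finset (A i)) :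
    ℕ → ∀ i, A i → Prop
  | 0, i, a => a ∉ α i
  | m + 1, i, a => a ∉ α i ∧ ∃ b, 0 < N i a b ∧ Avoids N α m (i + 1) b

section Paths

variable {A : ℕ → Type} {N : ∀ i, Matrix (A i) (A (i + 1)) ℝ} {α : ∀ i, Finset (A i)}

namespace Reach

theorem trans {i j k : ℕ} {a : A i} {b : A j} {c : A k} (hab : Reach N a j b)
    (hbc : Reach N b k c) : Reach N a k c := by
  induction hbc with
  | refl => exact hab
  | snoc _ h ih => exact ih.snoc h

theorem single {i : ℕ} {a : A i} {b : A (i + 1)} (h : 0 < N i a b) : Reach N a (i + 1) b :=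
  Reach.refl.snoc h

theorem exists_head_of_snoc {i j : ℕ} {a : A i} {b : A j} (h : Reach N a j b) :
    ∀ c, 0 < N j b c → ∃ d, 0 < N i a d ∧ Reach N d (j + 1) c := by
  induction h with
  | refl => exact fun c hc => ⟨c, hc, .refl⟩
  | snoc _ hb ih =>
    intro c hc
    obtain ⟨d, hd, hdb⟩ := ih _ hb
    exact ⟨d, hd, hdb.snoc hc⟩

theorem exists_head {i j : ℕ} {a : A i} {b : A j} (h : Reach N a j b) (hij : i < j) :
    ∃ d, 0 < N i a d ∧ Reach N d j b := by
  cases h with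
  | refl => exact absurd hij (lt_irrefl _)
  | snoc h hb => exact h.exists_head_of_snoc _ hb

theorem map {B : ℕ → Type} {M : ∀ i, Matrix (B i) (B (i + 1)) ℝ} (f : ∀ i, B i → A i)
    (hf : ∀ i a b, 0 < M i a b → 0 < N i (f i a) (f (i + 1) b)) {i j : ℕ} {a : B i} {b : B j}
    (h : Reach M a j b) : Reach N (f i a) j (f j b) := by
  induction h with
  | refl => exact .refl
  | snoc _ h ih => exact ih.snoc (hf _ _ _ h)

end Reach

theorem matProd_nonneg [∀ i, Fintype (A i)] (hN : ∀ i a b, 0 ≤ N i a b) (k m : ℕ)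
    (a : A k) (b : A (k + m + 1)) : 0 ≤ matProd N k m a b := by
  induction m with
  | zero => exact hN k a b
  | succ m ih => exact Finset.sum_nonneg fun c _ => mul_nonneg (ih c) (hN _ _ _)

theorem Reach.of_matProd_pos [∀ i, Fintype (A i)] (hN : ∀ i a b, 0 ≤ N i a b) (k m : ℕ)
    (a : A k) (b : A (k + m + 1)) (h : 0 < matProd N k m a b) : Reach N a (k + m + 1) b := by
  induction m with
  | zero => exact .single h
  | succ m ih =>
    obtain ⟨c, -, hc⟩ := Finset.exists_ne_zero_of_sum_ne_zero (ne_of_gt h)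
    exact (ih c ((matProd_nonneg hN k m a c).lt_of_ne' (left_ne_zero_of_mul hc))).snoc
      ((hN _ _ _).lt_of_ne' (right_ne_zero_of_mul hc))

theorem Reach.exists_matProd_pos [∀ i, Fintype (A i)] (hN : ∀ i a b, 0 ≤ N i a b)
    {k j : ℕ} {a : A k} {b : A j} (h : Reach N a j b) :
    ∀ c, 0 < N j b c → ∃ m, ∃ e : j + 1 = k + m + 1, 0 < matProd N k m a (e ▸ c) := by
  induction h with
  | refl => exact fun c hc => ⟨0, rfl, hc⟩
  | @snoc j b c _ hb ih =>
    intro d hd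
    obtain ⟨m, e, hm⟩ := ih c hb
    obtain rfl : j = k + m := by omega
    exact ⟨m + 1, rfl, Finset.sum_pos' (fun x _ => mul_nonneg (matProd_nonneg hN k m a x) (hN _ _ _))
      ⟨c, Finset.mem_univ _, mul_pos hm hd⟩⟩

theorem Reach.matProd_pos [∀ i, Fintype (A i)] (hN : ∀ i a b, 0 ≤ N i a b)
    {k m : ℕ} {a : A k} {b : A (k + m)} (h : Reach N a (k + m) b) {c : A (k + m + 1)}
    (hc : 0 < N (k + m) b c) : 0 < matProd N k m a c := by
  obtain ⟨m', e, hm⟩ := h.exists_matProd_pos hN c hc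
  obtain rfl : m = m' := by omega
  exact hm

theorem exists_reach_of_le (hpos : ∀ i (a : A i), ∃ b, 0 < N i a b) {i n : ℕ} (hin : i ≤ n)
    (a : A i) : ∃ b, Reach N a n b := by
  induction n, hin using Nat.le_induction with
  | base => exact ⟨a, .refl⟩
  | succ n _ ih =>
    obtain ⟨b, hb⟩ := ih
    obtain ⟨c, hc⟩ := hpos n b
    exact ⟨c, hb.snoc hc⟩

theorem exists_reach_to_of_le (hpos : ∀ i (b : A (i + 1)), ∃ a, 0 < N i a b) {i n : ℕ}
    (hin : i ≤ n) (b : A n) : ∃ a : A i, Reach N a n b := by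
  induction n, hin using Nat.le_induction with
  | base => exact ⟨b, .refl⟩
  | succ n _ ih =>
    obtain ⟨c, hc⟩ := hpos n b
    obtain ⟨a, ha⟩ := ih c
    exact ⟨a, ha.snoc hc⟩

namespace Avoids

theorem notMem {m i : ℕ} {a : A i} (h : Avoids N α m i a) : a ∉ α i := by
  cases m with
  | zero => exact h
  | succ m => exact h.1

theorem of_succ {m i : ℕ} {a : A i} (h : Avoids N α (m + 1) i a) : Avoids N α m i a := by
  induction m generalizing i with
  | zero => exact h.1
  | succ m ih =>
    obtain ⟨ha, b, hb, h⟩ := h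
    exact ⟨ha, b, hb, ih h⟩

theorem mono {m n i : ℕ} {a : A i} (hmn : m ≤ n) (h : Avoids N α n i a) : Avoids N α m i a := by
  induction n, hmn using Nat.le_induction with
  | base => exact h
  | succ n _ ih => exact ih h.of_succ

theorem of_reach {n : ℕ} {b : A n} (m : ℕ) {i : ℕ} {a : A i} (hi : i + m ≤ n)
    (h : Reach N a n b) (hα : ∀ j, i ≤ j → ∀ d : A j, Reach N d n b → d ∉ α j) :
    Avoids N α m i a := by
  induction m generalizing i with
  | zero => exact hα i le_rfl a h
  | succ m ih =>
    obtain ⟨d, hd, hdb⟩ := h.exists_head (by omega)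
    exact ⟨hα i le_rfl a h, d, hd, ih (by omega) hdb fun j hj => hα j (by omega)⟩

end Avoids

/-- An antitone sequence of nonempty predicates on a finite type has a common witness. -/
theorem exists_forall_of_antitone {β : Type*} [Finite β] {P : ℕ → β → Prop}
    (hP : ∀ m n b, m ≤ n → P n b → P m b) (h : ∀ m, ∃ b, P m b) : ∃ b, ∀ m, P m b := by
  by_contra! hne
  choose f hf using hne
  obtain ⟨M, hM⟩ := (Set.finite_range f).bddAbove
  obtain ⟨b, hb⟩ := h M
  exact hf b (hP _ _ b (hM ⟨b, rfl⟩) hb)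

theorem exists_next_of_forall_avoids [∀ i, Finite (A i)] {i : ℕ} {a : A i}
    (h : ∀ m, Avoids N α m i a) :
    ∃ b, 0 < N i a b ∧ ∀ m, Avoids N α m (i + 1) b := by
  obtain ⟨b, hb⟩ := exists_forall_of_antitone
    (P := fun m b => 0 < N i a b ∧ Avoids N α m (i + 1) b)
    (fun _ _ _ hmn hb => ⟨hb.1, hb.2.mono hmn⟩) fun m => (h (m + 1)).2
  exact ⟨b, (hb 0).1, fun m => (hb m).2⟩

/-- König's lemma for vertex paths avoiding a stream. -/
theorem exists_infinite_path_of_forall_avoids [∀ i, Finite (A i)] [∀ i, Nonempty (A i)] {k : ℕ}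
    (h : ∀ m, ∃ a, Avoids N α m k a) :
    ∃ x : ∀ i, A i, (∀ i, k ≤ i → 0 < N i (x i) (x (i + 1))) ∧ ∀ i, k ≤ i → x i ∉ α i := by
  classical
  let good : ∀ i, A i → Prop := fun i a => ∀ m, Avoids N α m i a
  have hk : ∃ a, good k a := exists_forall_of_antitone (fun _ _ _ hmn ha => ha.mono hmn) h
  have hnext : ∀ i (a : A i), ∃ b, (good i a → 0 < N i a b ∧ good (i + 1) b) ∧
      ((∃ c, good (i + 1) c) → good (i + 1) b) := by
    intro i a
    by_cases ha : good i a
    · obtain ⟨b, hb, hgood⟩ := exists_next_of_forall_avoids ha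
      exact ⟨b, fun _ => ⟨hb, hgood⟩, fun _ => hgood⟩
    · exact ⟨Classical.epsilon (good (i + 1)), fun h => absurd h ha, Classical.epsilon_spec⟩
  choose next hnext using hnext
  let x : ∀ i, A i := fun i => Nat.rec (Classical.epsilon (good 0)) next i
  have hx : ∀ i, k ≤ i → good i (x i) := by
    intro i hi
    induction i, hi using Nat.le_induction with
    | base =>
      cases k with
      | zero => exact Classical.epsilon_spec hk
      | succ k => exact (hnext k (x k)).2 hk
    | succ i _ ih => exact ((hnext i (x i)).1 ih).2
  exact ⟨x, fun i hi => ((hnext i (x i)).1 (hx i hi)).1, fun i hi => (hx i hi 0).notMem⟩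

namespace StreamReduced

variable {k₀ : ℕ}

theorem exists_reach (hα : StreamReduced N α k₀) (hN : ∀ i a b, 0 ≤ N i a b) {i n : ℕ}
    (hi : k₀ ≤ i) (hin : i ≤ n) {a : A i} (ha : a ∈ α i) : ∃ b ∈ α n, Reach N a n b := by
  induction n, hin using Nat.le_induction with
  | base => exact ⟨a, ha, .refl⟩
  | succ n hn ih =>
    obtain ⟨b, hb, hab⟩ := ih
    obtain ⟨c, hc⟩ := (hα n (hi.trans hn)).1 ⟨b, hb⟩
    exact ⟨c, c.2, hab.snoc ((hN _ _ _).lt_of_ne' hc)⟩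

theorem exists_reach_to (hα : StreamReduced N α k₀) (hN : ∀ i a b, 0 ≤ N i a b) {i n : ℕ}
    (hi : k₀ ≤ i) (hin : i ≤ n) {b : A n} (hb : b ∈ α n) : ∃ a ∈ α i, Reach N a n b := by
  induction n, hin using Nat.le_induction with
  | base => exact ⟨b, hb, .refl⟩
  | succ n hn ih =>
    obtain ⟨c, hc⟩ := (hα n (hi.trans hn)).2 ⟨b, hb⟩
    obtain ⟨a, ha, hac⟩ := ih c.2
    exact ⟨a, ha, hac.snoc ((hN _ _ _).lt_of_ne' hc)⟩

theorem exists_reach_of_not_avoids (hα : StreamReduced N α k₀) (hN : ∀ i a b, 0 ≤ N i a b)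
    (hpos : ∀ i (a : A i), ∃ b, 0 < N i a b) (m : ℕ) {i n : ℕ} (hi : k₀ ≤ i) (hn : i + m ≤ n)
    {a : A i} (ha : ¬ Avoids N α m i a) : ∃ b ∈ α n, Reach N a n b := by
  induction m generalizing i with
  | zero => exact hα.exists_reach hN hi hn (not_not.mp ha)
  | succ m ih =>
    by_cases hmem : a ∈ α i
    · exact hα.exists_reach hN hi (by omega) hmem
    · obtain ⟨c, hc⟩ := hpos i a
      obtain ⟨b, hb, hcb⟩ := ih (i := i + 1) (a := c) (by omega) (by omega)
        fun h => ha ⟨hmem, c, hc, h⟩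
      exact ⟨b, hb, (Reach.single hc).trans hcb⟩

theorem exists_reach_to_of_not_avoids (hα : StreamReduced N α k₀) (hN : ∀ i a b, 0 ≤ N i a b)
    (hpos : ∀ i (b : A (i + 1)), ∃ a, 0 < N i a b) {m i n : ℕ} (hi : k₀ ≤ i) (hn : i + m ≤ n)
    (h : ∀ a, ¬ Avoids N α m i a) (b : A n) : ∃ a ∈ α i, Reach N a n b := by
  by_contra! hne
  obtain ⟨a, ha⟩ := exists_reach_to_of_le hpos (show i ≤ n by omega) b
  refine h a (Avoids.of_reach m hn ha fun j hj d hd hmem => ?_)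
  obtain ⟨c, hc, hcd⟩ := hα.exists_reach_to hN hi hj hmem
  exact hne c hc (hcd.trans hd)

end StreamReduced

end Paths

/-- if `N` is reduced but not primitive, then for every reduced primitive
proper stream `α` there exist `k ≥ 0` and an infinite vertex path `x = (x_i)_{i ≥ k}`
disjoint from `α`. -/
theorem statement15 (A : ℕ → Type) [∀ i, Fintype (A i)] [∀ i, Nonempty (A i)]
    (N : ∀ i, Matrix (A i) (A (i + 1)) ℝ)
    (hN0 : ∀ i a b, 0 ≤ N i a b)
    (hrow : ∀ i (a : A i), ∃ b, N i a b ≠ 0)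
    (hcol : ∀ i (b : A (i + 1)), ∃ a, N i a b ≠ 0)
    (hnotprim : ¬ Primitive N)
    (α : ∀ i, Finset (A i)) (k₀ : ℕ)
    (hproper : StreamProper α k₀)
    (hαred : StreamReduced N α k₀)
    (hαprim : StreamPrimitive N α k₀) :
    ∃ (k : ℕ) (x : ∀ i, A i),
      (∀ i, k ≤ i → 0 < N i (x i) (x (i + 1))) ∧ ∀ i, k ≤ i → x i ∉ α i := by
  have hpos : ∀ i (a : A i), ∃ b, 0 < N i a b := fun i a =>
    (hrow i a).imp fun b hb => (hN0 i a b).lt_of_ne' hb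
  have hpos' : ∀ i (b : A (i + 1)), ∃ a, 0 < N i a b := fun i b =>
    (hcol i b).imp fun a ha => (hN0 i a b).lt_of_ne' ha
  by_contra! hne
  have hfin : ∀ k, ∃ m, ∀ a, ¬ Avoids N α m k a := by
    intro k
    by_contra! h
    obtain ⟨x, hx, hxα⟩ := exists_infinite_path_of_forall_avoids h
    obtain ⟨i, hi, hmem⟩ := hne k x hx
    exact hxα i hi hmem
  refine hnotprim fun k => ?_
  obtain ⟨m₁, h₁⟩ := hfin (max k k₀)
  obtain ⟨m₂, -, h₂⟩ := hαprim (max k k₀ + m₁) (by omega)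
  obtain ⟨m₃, h₃⟩ := hfin (max k k₀ + m₁ + m₂ + 1)
  obtain ⟨m, hm⟩ : ∃ m, k + m = max k k₀ + m₁ + m₂ + 1 + m₃ :=
    ⟨max k k₀ + m₁ + m₂ + 1 + m₃ - k, by omega⟩
  refine ⟨m, by omega, fun a c => ?_⟩
  obtain ⟨b, hbc⟩ := hpos' (k + m) c
  refine Reach.matProd_pos hN0 ?_ hbc
  obtain ⟨a', haa'⟩ := exists_reach_of_le hpos (le_max_left k k₀) a
  obtain ⟨p, hp, hap⟩ := hαred.exists_reach_of_not_avoids hN0 hpos m₁ (le_max_right k k₀) le_rfl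
    (h₁ a')
  obtain ⟨q, hq, hqb⟩ := hαred.exists_reach_to_of_not_avoids hN0 hpos' (by omega) hm.ge h₃ b
  have hpq : Reach N p _ q :=
    (Reach.of_matProd_pos (A := fun i => ↥(α i)) (N := subMat N α)
      (fun i a b => hN0 i a.1 b.1) _ _ _ _ (h₂ ⟨p, hp⟩ ⟨q, hq⟩)).map
      (fun _ => Subtype.val) fun _ _ _ h => h
  exact ((haa'.trans hap).trans hpq).trans hqb
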